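/- arXiv:2604.15970 — 4 statements merged into one kernel-verified Lean document; each statement's English description precedes it below -/
import Mathlib

section
/- Let A be a Boolean algebra, fix e ∈ A, and define E : A × A → A × A by E (a, b) = ((aᶜ ⊔ e) ⊓ bᶜ, (aᶜ ⊔ e) ⊓ b). Define on A × A the join (a, b) ⊔ (c, d) = (a ⊔ c, b ⊔ d) and the multiplication (a, b) ∧ (c, d) = (a ⊓ c, (a ⊓ d) ⊔ (b ⊓ c) ⊔ (b ⊓ d)). Then for all X, Y ∈ A × A, E (X ⊔ Y) = E X ∧ E Y. -/
/-- The join `(a, b) ⊔ (c, d) = (a ⊔ c, b ⊔ d)` on `A × A`. -/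
def bSup {A : Type*} [BooleanAlgebra A] (X Y : A × A) : A × A :=
  (X.1 ⊔ Y.1, X.2 ⊔ Y.2)

/-- The multiplication `(a, b) ∧ (c, d) = (a ⊓ c, (a ⊓ d) ⊔ (b ⊓ c) ⊔ (b ⊓ d))` on `A × A`. -/
def bMul {A : Type*} [BooleanAlgebra A] (X Y : A × A) : A × A :=
  (X.1 ⊓ Y.1, (X.1 ⊓ Y.2) ⊔ (X.2 ⊓ Y.1) ⊔ (X.2 ⊓ Y.2))

/-- The extended exponential `E (a, b) = ((aᶜ ⊔ e) ⊓ bᶜ, (aᶜ ⊔ e) ⊓ b)` on `A × A`. -/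
def expE2 {A : Type*} [BooleanAlgebra A] (e : A) (X : A × A) : A × A :=
  ((X.1ᶜ ⊔ e) ⊓ X.2ᶜ, (X.1ᶜ ⊔ e) ⊓ X.2)

/-- A join splits into the two one-sided differences and the meet. -/
theorem compl_inf_sup_inf_compl_sup_inf {A : Type*} [BooleanAlgebra A] (b d : A) :
    (bᶜ ⊓ d) ⊔ (b ⊓ dᶜ) ⊔ (b ⊓ d) = b ⊔ d := by
  rw [sup_assoc, ← inf_sup_left, compl_sup_eq_top, inf_top_eq, sup_comm, sup_inf_left,
    sup_compl_eq_top, top_inf_eq]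

theorem expE2_sup {A : Type*} [BooleanAlgebra A] (e : A) (X Y : A × A) :
    expE2 e (bSup X Y) = bMul (expE2 e X) (expE2 e Y) := by
  obtain ⟨a, b⟩ := X
  obtain ⟨c, d⟩ := Y
  have h : (a ⊔ c)ᶜ ⊔ e = (aᶜ ⊔ e) ⊓ (cᶜ ⊔ e) := by rw [compl_sup, sup_inf_right]
  ext
  · simp only [expE2, bSup, bMul]
    rw [h, compl_sup, inf_inf_inf_comm]
  · simp only [expE2, bSup, bMul]
    rw [h, inf_inf_inf_comm (aᶜ ⊔ e) bᶜ, inf_inf_inf_comm (aᶜ ⊔ e) b,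
      inf_inf_inf_comm (aᶜ ⊔ e) b, ← inf_sup_left, ← inf_sup_left,
      compl_inf_sup_inf_compl_sup_inf]
end

section
/- Let A be a Boolean algebra and fix x ∈ A. Define φ : A × A → A × A by φ (a, b) = (a ⊔ (x ⊓ b), (xᶜ ⊔ (x ⊓ a)) ⊓ b). Then φ satisfies the Braid Condition on A × A × A: (φ × id) ∘ (id × φ) ∘ (φ × id) = (id × φ) ∘ (φ × id) ∘ (id × φ), where (φ × id)(a, b, c) = (φ(a, b), c) and (id × φ)(a, b, c) = (a, φ(b, c)). -/
/-- `φ¹² = φ × id` acting on the first two factors of `A × A × A`. -/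
def phi12 {A : Type*} (φ : A × A → A × A) : A × A × A → A × A × A :=
  fun t => ((φ (t.1, t.2.1)).1, (φ (t.1, t.2.1)).2, t.2.2)

/-- `φ²³ = id × φ` acting on the last two factors of `A × A × A`. -/
def phi23 {A : Type*} (φ : A × A → A × A) : A × A × A → A × A × A :=
  fun t => (t.1, φ (t.2.1, t.2.2))

theorem toBoolRing_sup {A : Type*} [BooleanAlgebra A] (a b : A) :
    toBoolRing (a ⊔ b) = toBoolRing a + toBoolRing b + toBoolRing a * toBoolRing b := by
  rw [← toBoolRing_symmDiff, ← toBoolRing_inf, ← toBoolRing_symmDiff, symmDiff_symmDiff_inf]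

theorem toBoolRing_compl {A : Type*} [BooleanAlgebra A] (a : A) :
    toBoolRing aᶜ = 1 + toBoolRing a := by
  rw [← toBoolRing_top, ← toBoolRing_symmDiff, top_symmDiff, hnot_eq_compl]

theorem braid_general {A : Type*} [BooleanAlgebra A] (x : A) :
    let φ : A × A → A × A := fun p => (p.1 ⊔ (x ⊓ p.2), (xᶜ ⊔ (x ⊓ p.1)) ⊓ p.2)
    phi12 φ ∘ phi23 φ ∘ phi12 φ = phi23 φ ∘ phi12 φ ∘ phi23 φ := by
  intro φ
  funext ⟨a, b, c⟩
  have h2 : (2 : AsBoolRing A) = 0 := by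
    rw [← one_add_one_eq_two]; exact BooleanRing.add_self 1
  have hx := BooleanRing.mul_self (toBoolRing x)
  have ha := BooleanRing.mul_self (toBoolRing a)
  have hb := BooleanRing.mul_self (toBoolRing b)
  have hc := BooleanRing.mul_self (toBoolRing c)
  simp only [φ, phi12, phi23, Function.comp_apply, Prod.mk.injEq]
  refine ⟨?_, ?_, ?_⟩ <;> apply toBoolRing.injective <;>
    simp only [toBoolRing_sup, toBoolRing_inf, toBoolRing_compl] <;> grind
end

section
/- Let A be a Boolean algebra and define P : A × A → A × A by P (a, b) = (a ⊔ b, a ⊓ b). Then P satisfies the Braid Condition on A × A × A: (P × id) ∘ (id × P) ∘ (P × id) = (id × P) ∘ (P × id) ∘ (id × P), where (P × id)(a, b, c) = (P(a, b), c) and (id × P)(a, b, c) = (a, P(b, c)). -/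
/-- Two lattice expressions for the median of three elements. -/
theorem sup_inf_inf_sup_eq_inf_sup_sup_inf {A : Type*} [DistribLattice A] (a b c : A) :
    (a ⊔ b) ⊓ (a ⊓ b ⊔ c) = a ⊓ (b ⊔ c) ⊔ b ⊓ c := by
  rw [inf_sup_left, inf_eq_right.mpr (inf_le_left.trans le_sup_left), inf_sup_right,
    inf_sup_left, sup_assoc]

theorem braid_P {A : Type*} [BooleanAlgebra A] :
    let P : A × A → A × A := fun p => (p.1 ⊔ p.2, p.1 ⊓ p.2)
    phi12 P ∘ phi23 P ∘ phi12 P = phi23 P ∘ phi12 P ∘ phi23 P := by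
  intro P
  funext ⟨a, b, c⟩
  refine Prod.ext ?_ (Prod.ext ?_ ?_)
  · change a ⊔ b ⊔ (a ⊓ b ⊔ c) = a ⊔ (b ⊔ c)
    rw [← sup_assoc, sup_eq_left.mpr (inf_le_sup (a := a) (b := b)), sup_assoc]
  · exact sup_inf_inf_sup_eq_inf_sup_sup_inf a b c
  · change a ⊓ b ⊓ c = a ⊓ (b ⊔ c) ⊓ (b ⊓ c)
    rw [inf_assoc a (b ⊔ c), inf_eq_right.mpr (inf_le_sup (a := b) (b := c)), inf_assoc]
end

section
/- Let A be a 2 × 2 real matrix with det A = 1. Then ∑_{k=1}^{9} A^k = (trace(A) + 1) · (trace(A³) + 1) · A⁵, where the scalar (trace(A) + 1)(trace(A³) + 1) multiplies the matrix A⁵. -/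
open Matrix

theorem Matrix.pow_add_two_of_det_eq_one {R : Type*} [CommRing R]
    {A : Matrix (Fin 2) (Fin 2) R} (hA : A.det = 1) (n : ℕ) :
    A ^ (n + 2) = A.trace • A ^ (n + 1) - A ^ n := by
  have h : A ^ 2 = A.trace • A - 1 := by
    rw [det_fin_two] at hA
    ext i j
    fin_cases i <;> fin_cases j <;>
      simp [pow_two, mul_apply, Fin.sum_univ_two, trace_fin_two] <;> grind
  rw [pow_add, h, mul_sub, mul_one, mul_smul_comm, ← pow_succ]

theorem sum_pow_eq {A : Matrix (Fin 2) (Fin 2) ℝ} (hA : A.det = 1) :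
    ∑ k ∈ Finset.Icc 1 9, A ^ k =
      ((A.trace + 1) * ((A ^ 3).trace + 1)) • A ^ 5 := by
  have h := pow_add_two_of_det_eq_one hA
  have h_trace : (A ^ 3).trace = A.trace ^ 3 - 3 * A.trace := by
    rw [h 1, h 0]
    simp
    ring
  have h_sum : ∑ k ∈ Finset.Icc 1 9, A ^ k =
      A ^ 1 + A ^ 2 + A ^ 3 + A ^ 4 + A ^ 5 + A ^ 6 + A ^ 7 + A ^ 8 + A ^ 9 := by
    simp [Finset.sum_Icc_succ_top]
  rw [h_sum, h_trace, h 7, h 6, h 5, h 4, h 3, h 2, h 1, h 0]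
  module
end
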